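/- arXiv:1110.6674 — 14 statements merged into one kernel-verified Lean document; each statement's English description precedes it below -/
import Mathlib

section
/- Let e₁, e₂, e₃ ∈ ℂ∖{0} and let x₁, x₂, x₃ ∈ ℂ be pairwise distinct. Let P₁, P₂, P₃ be the pants matrices associated to (e₁,e₂,e₃,x₁,x₂,x₃). Then for each i (indices mod 3): det Pᵢ = 1; P₁P₂P₃ = I; Pᵢ·(xᵢ, 1)ᵀ = eᵢ·(xᵢ, 1)ᵀ; and Pᵢ·(Nᵢ, Dᵢ)ᵀ = eᵢ⁻¹·(Nᵢ, Dᵢ)ᵀ, where Nᵢ = eᵢ²e_{i+1}x_{i+1}(xᵢ − x_{i+2}) + e_{i+1}x_{i+2}(x_{i+1} − xᵢ) + eᵢe_{i+2}xᵢ(x_{i+2} − x_{i+1}) and Dᵢ = eᵢ²e_{i+1}(xᵢ − x_{i+2}) + e_{i+1}(x_{i+1} − xᵢ) + eᵢe_{i+2}(x_{i+2} − x_{i+1}); thus when Dᵢ ≠ 0 the other fixed point of Pᵢ is yᵢ = Nᵢ/Dᵢ. -/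
open Matrix

/-- The pants matrix `Pᵢ` associated to data `(eᵢ, e_{i+1}, e_{i+2}, xᵢ, x_{i+1}, x_{i+2})`
(written here as `(a, b, c, u, v, w)`). -/
noncomputable def pantsMatrix (a b c u v w : ℂ) : Matrix (Fin 2) (Fin 2) ℂ :=
  (1 / (a * b * (v - u) * (w - u))) •
    !![a^2*b*u*(u-w) + b*w*(v-u) + a*c*u*(w-v),
       u*(a^2*b*v*(w-u) + b*w*(u-v) + a*c*u*(v-w));
       a^2*b*(u-w) + b*(v-u) + a*c*(w-v),
       a^2*b*v*(w-u) + b*u*(u-v) + a*c*u*(v-w)]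

/-- The numerator `Nᵢ` of the second fixed point `yᵢ` of `Pᵢ`. -/
noncomputable def pantsN (a b c u v w : ℂ) : ℂ :=
  a^2*b*v*(u-w) + b*w*(v-u) + a*c*u*(w-v)

/-- The denominator `Dᵢ` of the second fixed point `yᵢ` of `Pᵢ`. -/
noncomputable def pantsD (a b c u v w : ℂ) : ℂ :=
  a^2*b*(u-w) + b*(v-u) + a*c*(w-v)

section PantsMatrix

variable {a b c u v w : ℂ}

lemma det_pantsMatrix (ha : a ≠ 0) (hb : b ≠ 0) (huv : v - u ≠ 0) (huw : w - u ≠ 0) :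
    (pantsMatrix a b c u v w).det = 1 := by
  simp only [pantsMatrix, det_smul, det_fin_two_of, Fintype.card_fin]
  field_simp
  ring

lemma pantsMatrix_mulVec_fixedPoint (ha : a ≠ 0) (hb : b ≠ 0) (huv : v - u ≠ 0)
    (huw : w - u ≠ 0) :
    (pantsMatrix a b c u v w).mulVec ![u, 1] = a • ![u, 1] := by
  ext i
  fin_cases i <;> simp [pantsMatrix, mulVec, dotProduct, Fin.sum_univ_two] <;> field_simp <;> ring

lemma pantsMatrix_mulVec_otherFixedPoint (ha : a ≠ 0) (hb : b ≠ 0) (huv : v - u ≠ 0)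
    (huw : w - u ≠ 0) :
    (pantsMatrix a b c u v w).mulVec ![pantsN a b c u v w, pantsD a b c u v w]
      = a⁻¹ • ![pantsN a b c u v w, pantsD a b c u v w] := by
  ext i
  fin_cases i <;> simp [pantsMatrix, pantsN, pantsD, mulVec, dotProduct, Fin.sum_univ_two] <;>
    field_simp <;> ring

lemma pantsMatrix_mul_pantsMatrix (ha : a ≠ 0) (hb : b ≠ 0) (hc : c ≠ 0) (huv : v - u ≠ 0)
    (hvw : w - v ≠ 0) (huw : w - u ≠ 0) :
    pantsMatrix a b c u v w * pantsMatrix b c a v w u = (pantsMatrix c a b w u v).adjugate := by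
  have hvu : u - v ≠ 0 := by rwa [← neg_sub, neg_ne_zero]
  have hwu : u - w ≠ 0 := by rwa [← neg_sub, neg_ne_zero]
  have hwv : v - w ≠ 0 := by rwa [← neg_sub, neg_ne_zero]
  rw [adjugate_fin_two]
  ext i j
  fin_cases i <;> fin_cases j <;>
    simp [pantsMatrix, mul_apply, Fin.sum_univ_two] <;> field_simp <;> ring

end PantsMatrix

/-- the pants matrices have determinant one, product the identity,
eigenvector `(xᵢ,1)ᵀ` with eigenvalue `eᵢ`, and eigenvector `(Nᵢ,Dᵢ)ᵀ` with
eigenvalue `eᵢ⁻¹` (so the other fixed point of `Pᵢ` is `yᵢ = Nᵢ/Dᵢ` when `Dᵢ ≠ 0`). -/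
theorem pants_matrices_properties
    (e₁ e₂ e₃ x₁ x₂ x₃ : ℂ) (he₁ : e₁ ≠ 0) (he₂ : e₂ ≠ 0) (he₃ : e₃ ≠ 0)
    (h12 : x₁ ≠ x₂) (h23 : x₂ ≠ x₃) (h13 : x₁ ≠ x₃) :
    (pantsMatrix e₁ e₂ e₃ x₁ x₂ x₃).det = 1 ∧
    (pantsMatrix e₂ e₃ e₁ x₂ x₃ x₁).det = 1 ∧
    (pantsMatrix e₃ e₁ e₂ x₃ x₁ x₂).det = 1 ∧
    pantsMatrix e₁ e₂ e₃ x₁ x₂ x₃ * pantsMatrix e₂ e₃ e₁ x₂ x₃ x₁ *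
      pantsMatrix e₃ e₁ e₂ x₃ x₁ x₂ = 1 ∧
    (pantsMatrix e₁ e₂ e₃ x₁ x₂ x₃).mulVec ![x₁, 1] = e₁ • ![x₁, 1] ∧
    (pantsMatrix e₂ e₃ e₁ x₂ x₃ x₁).mulVec ![x₂, 1] = e₂ • ![x₂, 1] ∧
    (pantsMatrix e₃ e₁ e₂ x₃ x₁ x₂).mulVec ![x₃, 1] = e₃ • ![x₃, 1] ∧
    (pantsMatrix e₁ e₂ e₃ x₁ x₂ x₃).mulVec
        ![pantsN e₁ e₂ e₃ x₁ x₂ x₃, pantsD e₁ e₂ e₃ x₁ x₂ x₃]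
      = e₁⁻¹ • ![pantsN e₁ e₂ e₃ x₁ x₂ x₃, pantsD e₁ e₂ e₃ x₁ x₂ x₃] ∧
    (pantsMatrix e₂ e₃ e₁ x₂ x₃ x₁).mulVec
        ![pantsN e₂ e₃ e₁ x₂ x₃ x₁, pantsD e₂ e₃ e₁ x₂ x₃ x₁]
      = e₂⁻¹ • ![pantsN e₂ e₃ e₁ x₂ x₃ x₁, pantsD e₂ e₃ e₁ x₂ x₃ x₁] ∧
    (pantsMatrix e₃ e₁ e₂ x₃ x₁ x₂).mulVec
        ![pantsN e₃ e₁ e₂ x₃ x₁ x₂, pantsD e₃ e₁ e₂ x₃ x₁ x₂]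
      = e₃⁻¹ • ![pantsN e₃ e₁ e₂ x₃ x₁ x₂, pantsD e₃ e₁ e₂ x₃ x₁ x₂] := by
  have h21 : x₂ - x₁ ≠ 0 := sub_ne_zero.2 h12.symm
  have h32 : x₃ - x₂ ≠ 0 := sub_ne_zero.2 h23.symm
  have h31 : x₃ - x₁ ≠ 0 := sub_ne_zero.2 h13.symm
  have h12' : x₁ - x₂ ≠ 0 := sub_ne_zero.2 h12
  have h23' : x₂ - x₃ ≠ 0 := sub_ne_zero.2 h23
  have h13' : x₁ - x₃ ≠ 0 := sub_ne_zero.2 h13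
  refine ⟨det_pantsMatrix he₁ he₂ h21 h31, det_pantsMatrix he₂ he₃ h32 h12',
    det_pantsMatrix he₃ he₁ h13' h23', ?_,
    pantsMatrix_mulVec_fixedPoint he₁ he₂ h21 h31,
    pantsMatrix_mulVec_fixedPoint he₂ he₃ h32 h12',
    pantsMatrix_mulVec_fixedPoint he₃ he₁ h13' h23',
    pantsMatrix_mulVec_otherFixedPoint he₁ he₂ h21 h31,
    pantsMatrix_mulVec_otherFixedPoint he₂ he₃ h32 h12',
    pantsMatrix_mulVec_otherFixedPoint he₃ he₁ h13' h23'⟩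
  rw [pantsMatrix_mul_pantsMatrix he₁ he₂ he₃ h21 h32 h31, adjugate_mul,
    det_pantsMatrix he₃ he₁ h13' h23', one_smul]
end

section
/- Let e₁, e₂, e₃ ∈ ℂ∖{0, 1, −1} satisfy e₁ ≠ e₂e₃, e₂ ≠ e₃e₁, e₃ ≠ e₁e₂, and e₁e₂e₃ ≠ 1, and let x₁, x₂, x₃ ∈ ℂ be pairwise distinct. Suppose A₁, A₂, A₃ are 2×2 complex matrices with det Aᵢ = 1 for each i, A₁A₂A₃ = I, and Aᵢ·(xᵢ, 1)ᵀ = eᵢ·(xᵢ, 1)ᵀ for each i. Then each Aᵢ equals the pants matrix Pᵢ associated to (e₁,e₂,e₃,x₁,x₂,x₃); in particular the representation is uniquely determined by the data (eᵢ, xᵢ). -/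
open Matrix

/-- A matrix of determinant `1` with eigenvector `(u, 1)` of eigenvalue `a` is determined by its
lower left entry. -/
theorem entries_of_det_eq_one_of_mulVec {A : Matrix (Fin 2) (Fin 2) ℂ} {a u : ℂ} (ha : a ≠ 0)
    (hdet : A.det = 1) (hev : A.mulVec ![u, 1] = a • ![u, 1]) :
    A 0 0 = a⁻¹ + u * A 1 0 ∧ A 0 1 = a * u - u * a⁻¹ - u ^ 2 * A 1 0 ∧
      A 1 1 = a - u * A 1 0 := by
  have h0 := congrFun hev 0
  have h1 := congrFun hev 1
  simp [Matrix.mulVec, dotProduct, Fin.sum_univ_two] at h0 h1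
  rw [Matrix.det_fin_two] at hdet
  have h00 : A 0 0 = a⁻¹ + u * A 1 0 := by
    field_simp
    linear_combination hdet + A 1 0 * h0 - A 0 0 * h1
  refine ⟨h00, ?_, ?_⟩
  · linear_combination h0 - u * h00
  · linear_combination h1

/-- The first of three matrices forming a pants representation is a pants matrix. -/
theorem eq_pantsMatrix_of_mul_mul_eq_one {A B C : Matrix (Fin 2) (Fin 2) ℂ} {a b c u v w : ℂ}
    (ha : a ≠ 0) (hb : b ≠ 0) (huv : u ≠ v) (huw : u ≠ w)
    (hdetA : A.det = 1) (hdetB : B.det = 1) (hprod : A * B * C = 1)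
    (hA : A.mulVec ![u, 1] = a • ![u, 1]) (hB : B.mulVec ![v, 1] = b • ![v, 1])
    (hC : C.mulVec ![w, 1] = c • ![w, 1]) :
    A = pantsMatrix a b c u v w := by
  obtain ⟨hA00, hA01, hA11⟩ := entries_of_det_eq_one_of_mulVec ha hdetA hA
  obtain ⟨hB00, hB01, hB11⟩ := entries_of_det_eq_one_of_mulVec hb hdetB hB
  have hBC : B * C = A.adjugate := by
    calc B * C = A.adjugate * A * (B * C) := by rw [Matrix.adjugate_mul, hdetA]; simp
      _ = A.adjugate * (A * B * C) := by simp only [Matrix.mul_assoc]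
      _ = A.adjugate := by rw [hprod, mul_one]
  have hw : c • B.mulVec ![w, 1] = A.adjugate.mulVec ![w, 1] := by
    rw [← hBC, ← Matrix.mulVec_mulVec, hC, Matrix.mulVec_smul]
  have hw0 := congrFun hw 0
  have hw1 := congrFun hw 1
  simp [Matrix.adjugate_fin_two, Matrix.mulVec, dotProduct, Fin.sum_univ_two] at hw0 hw1
  rw [hA01, hA11, hB00, hB01] at hw0
  rw [hA00, hB11] at hw1
  have hvu : v - u ≠ 0 := sub_ne_zero.mpr huv.symm
  have hwu : w - u ≠ 0 := sub_ne_zero.mpr huw.symm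
  have hA10 : A 1 0 = (a ^ 2 * b * (u - w) + b * (v - u) + a * c * (w - v)) /
      (a * b * (v - u) * (w - u)) := by
    rw [eq_div_iff (by positivity)]
    field_simp at hw0 hw1
    linear_combination v * b * hw1 - hw0
  ext i j
  fin_cases i <;> fin_cases j <;>
    simp [pantsMatrix, hA00, hA01, hA11, hA10] <;> field_simp <;> ring

/-- an irreducible pants representation is uniquely determined by the
eigenvalues `eᵢ` and fixed points `xᵢ`: any SL(2,ℂ) matrices `A₁, A₂, A₃` with
`A₁A₂A₃ = I` and `Aᵢ(xᵢ,1)ᵀ = eᵢ(xᵢ,1)ᵀ` are the pants matrices. -/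
theorem pants_representation_unique
    (e₁ e₂ e₃ x₁ x₂ x₃ : ℂ)
    (he₁0 : e₁ ≠ 0) (he₁1 : e₁ ≠ 1) (he₁m : e₁ ≠ -1)
    (he₂0 : e₂ ≠ 0) (he₂1 : e₂ ≠ 1) (he₂m : e₂ ≠ -1)
    (he₃0 : e₃ ≠ 0) (he₃1 : e₃ ≠ 1) (he₃m : e₃ ≠ -1)
    (hirr₁ : e₁ ≠ e₂ * e₃) (hirr₂ : e₂ ≠ e₃ * e₁) (hirr₃ : e₃ ≠ e₁ * e₂)
    (hirr₄ : e₁ * e₂ * e₃ ≠ 1)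
    (h12 : x₁ ≠ x₂) (h23 : x₂ ≠ x₃) (h13 : x₁ ≠ x₃)
    (A₁ A₂ A₃ : Matrix (Fin 2) (Fin 2) ℂ)
    (hdet₁ : A₁.det = 1) (hdet₂ : A₂.det = 1) (hdet₃ : A₃.det = 1)
    (hprod : A₁ * A₂ * A₃ = 1)
    (hev₁ : A₁.mulVec ![x₁, 1] = e₁ • ![x₁, 1])
    (hev₂ : A₂.mulVec ![x₂, 1] = e₂ • ![x₂, 1])
    (hev₃ : A₃.mulVec ![x₃, 1] = e₃ • ![x₃, 1]) :
    A₁ = pantsMatrix e₁ e₂ e₃ x₁ x₂ x₃ ∧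
    A₂ = pantsMatrix e₂ e₃ e₁ x₂ x₃ x₁ ∧
    A₃ = pantsMatrix e₃ e₁ e₂ x₃ x₁ x₂ := by
  have hprod₂ : A₂ * A₃ * A₁ = 1 := by
    rw [Matrix.mul_assoc] at hprod
    exact mul_eq_one_comm.mp hprod
  have hprod₃ : A₃ * A₁ * A₂ = 1 := by
    rw [Matrix.mul_assoc]
    exact mul_eq_one_comm.mp hprod
  exact ⟨eq_pantsMatrix_of_mul_mul_eq_one he₁0 he₂0 h12 h13 hdet₁ hdet₂ hprod hev₁ hev₂ hev₃,
    eq_pantsMatrix_of_mul_mul_eq_one he₂0 he₃0 h23 h12.symm hdet₂ hdet₃ hprod₂ hev₂ hev₃ hev₁,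
    eq_pantsMatrix_of_mul_mul_eq_one he₃0 he₁0 h13.symm h23.symm hdet₃ hdet₁ hprod₃
      hev₃ hev₁ hev₂⟩
end

section
/- Let x₁, x₂, x₃ ∈ ℂ be pairwise distinct and let e₁, e₂, e₃ ∈ ℂ∖{0, 1, −1}. Let P₁, P₂, P₃ be the pants matrices associated to (e₁,e₂,e₃,x₁,x₂,x₃). Then there exists a nonzero vector v ∈ ℂ² which is simultaneously an eigenvector of P₁, P₂, and P₃ (equivalently, the group generated by P₁, P₂, P₃ fixes a point of ℂP¹, i.e. the representation is reducible) if and only if e₁ = e₂e₃, or e₂ = e₃e₁, or e₃ = e₁e₂, or e₁e₂e₃ = 1. -/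
open Matrix

/-- A vector is a multiple of a nonzero vector of the plane iff their determinant vanishes. -/
theorem exists_eq_smul_iff_cross_eq_zero {K : Type*} [Field K] {v w : Fin 2 → K} (hv : v ≠ 0) :
    (∃ l : K, w = l • v) ↔ w 0 * v 1 - w 1 * v 0 = 0 := by
  constructor
  · rintro ⟨l, rfl⟩
    simp only [Pi.smul_apply, smul_eq_mul]
    ring
  · intro h
    by_cases h0 : v 0 = 0
    · have h1 : v 1 ≠ 0 := by
        intro h1
        exact hv (by ext i; fin_cases i <;> assumption)
      have hw : w 0 = 0 := by simpa [h0, h1] using h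
      refine ⟨w 1 / v 1, ?_⟩
      ext i
      fin_cases i <;> simp [h0, h1, hw]
    · refine ⟨w 0 / v 0, ?_⟩
      ext i
      fin_cases i
      · simp [h0]
      · simp only [Fin.mk_one, Pi.smul_apply, smul_eq_mul]
        field_simp
        linear_combination -h

/-- The fixed points of a pants matrix are the zeros of a product of two linear forms, the first of
which vanishes at `u`. -/
theorem pantsMatrix_mulVec_eq_smul_iff {a b c u v w : ℂ} (ha : a ≠ 0) (hb : b ≠ 0)
    (huv : u ≠ v) (huw : u ≠ w) {x : Fin 2 → ℂ} (hx : x ≠ 0) :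
    (∃ l : ℂ, (pantsMatrix a b c u v w).mulVec x = l • x) ↔
      x 0 - u * x 1 = 0 ∨
        a * c * ((v - w) * (x 0 - u * x 1)) + a ^ 2 * b * ((w - u) * (x 0 - v * x 1)) +
          b * ((u - v) * (x 0 - w * x 1)) = 0 := by
  have hscale : 1 / (a * b * (v - u) * (w - u)) ≠ 0 :=
    one_div_ne_zero (mul_ne_zero (mul_ne_zero (mul_ne_zero ha hb) (sub_ne_zero.2 huv.symm))
      (sub_ne_zero.2 huw.symm))
  have hform : (pantsMatrix a b c u v w).mulVec x 0 * x 1 -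
      (pantsMatrix a b c u v w).mulVec x 1 * x 0 =
      1 / (a * b * (v - u) * (w - u)) * ((x 0 - u * x 1) *
        (a * c * ((v - w) * (x 0 - u * x 1)) + a ^ 2 * b * ((w - u) * (x 0 - v * x 1)) +
          b * ((u - v) * (x 0 - w * x 1)))) := by
    simp only [pantsMatrix, smul_eq_mul, mulVec, dotProduct,
      Fin.sum_univ_two, Matrix.smul_apply, of_apply, cons_val_zero, cons_val_one, cons_val',
      cons_val_fin_one]
    ring
  rw [exists_eq_smul_iff_cross_eq_zero hx, hform, mul_eq_zero, or_iff_right hscale, mul_eq_zero]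

/-- A nonzero vector killed by `x 0 - u * x 1` is not killed by `x 0 - v * x 1` when `u ≠ v`. -/
theorem sub_mul_ne_zero_of_sub_mul_eq_zero {K : Type*} [Field K] {u v : K} (huv : u ≠ v)
    {x : Fin 2 → K} (hx : x ≠ 0) (hu : x 0 - u * x 1 = 0) : x 0 - v * x 1 ≠ 0 := by
  intro hv
  have h1 : x 1 = 0 := by
    refine (mul_eq_zero.1 (?_ : (u - v) * x 1 = 0)).resolve_left (sub_ne_zero.2 huv)
    linear_combination hv - hu
  have h0 : x 0 = 0 := by simpa [h1] using hu
  exact hx (by ext i; fin_cases i <;> assumption)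

/-- If the fixed point `u` of one pants matrix is also fixed by the next one, then `a = b * c`. -/
theorem eq_mul_of_pants_form_eq_zero {a b c u v w : ℂ} (hb : b ≠ 0) (huv : u ≠ v) (huw : u ≠ w)
    {x : Fin 2 → ℂ} (hx : x ≠ 0) (hu : x 0 - u * x 1 = 0)
    (h : x 0 - v * x 1 = 0 ∨
      b * a * ((w - u) * (x 0 - v * x 1)) + b ^ 2 * c * ((u - v) * (x 0 - w * x 1)) +
        c * ((v - w) * (x 0 - u * x 1)) = 0) : a = b * c := by
  have hv := sub_mul_ne_zero_of_sub_mul_eq_zero huv hx hu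
  have h' := h.resolve_left hv
  have : b * (w - u) * (x 0 - v * x 1) * (a - b * c) = 0 := by
    linear_combination h' + (b ^ 2 - 1) * c * (v - w) * hu
  exact sub_eq_zero.1 ((mul_eq_zero.1 this).resolve_left
    (mul_ne_zero (mul_ne_zero hb (sub_ne_zero.2 huw.symm)) hv))


/-- the pants representation is reducible (the three pants matrices have
a common eigenvector) if and only if `e₁ = e₂e₃`, `e₂ = e₃e₁`, `e₃ = e₁e₂`, or
`e₁e₂e₃ = 1`. -/
theorem pants_representation_reducible_iff
    (e₁ e₂ e₃ x₁ x₂ x₃ : ℂ)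
    (he₁0 : e₁ ≠ 0) (he₁1 : e₁ ≠ 1) (he₁m : e₁ ≠ -1)
    (he₂0 : e₂ ≠ 0) (he₂1 : e₂ ≠ 1) (he₂m : e₂ ≠ -1)
    (he₃0 : e₃ ≠ 0) (he₃1 : e₃ ≠ 1) (he₃m : e₃ ≠ -1)
    (h12 : x₁ ≠ x₂) (h23 : x₂ ≠ x₃) (h13 : x₁ ≠ x₃) :
    (∃ v : Fin 2 → ℂ, v ≠ 0 ∧
      (∃ l₁ : ℂ, (pantsMatrix e₁ e₂ e₃ x₁ x₂ x₃).mulVec v = l₁ • v) ∧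
      (∃ l₂ : ℂ, (pantsMatrix e₂ e₃ e₁ x₂ x₃ x₁).mulVec v = l₂ • v) ∧
      (∃ l₃ : ℂ, (pantsMatrix e₃ e₁ e₂ x₃ x₁ x₂).mulVec v = l₃ • v))
    ↔ (e₁ = e₂ * e₃ ∨ e₂ = e₃ * e₁ ∨ e₃ = e₁ * e₂ ∨ e₁ * e₂ * e₃ = 1) := by
  have key := fun (v : Fin 2 → ℂ) (hv : v ≠ 0) =>
    and_congr (pantsMatrix_mulVec_eq_smul_iff (c := e₃) he₁0 he₂0 h12 h13 hv)
      (and_congr (pantsMatrix_mulVec_eq_smul_iff (c := e₁) he₂0 he₃0 h23 h12.symm hv)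
        (pantsMatrix_mulVec_eq_smul_iff (c := e₂) he₃0 he₁0 h13.symm h23.symm hv))
  constructor
  · rintro ⟨v, hv, h⟩
    obtain ⟨h1, h2, h3⟩ := (key v hv).1 h
    by_cases hA : v 0 - x₁ * v 1 = 0
    · exact Or.inl (eq_mul_of_pants_form_eq_zero he₂0 h12 h13 hv hA h2)
    by_cases hB : v 0 - x₂ * v 1 = 0
    · exact Or.inr (Or.inl (eq_mul_of_pants_form_eq_zero he₃0 h23 h12.symm hv hB h3))
    by_cases hC : v 0 - x₃ * v 1 = 0
    · exact Or.inr (Or.inr (Or.inl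
        (eq_mul_of_pants_form_eq_zero he₁0 h13.symm h23.symm hv hC h1)))
    have h1 := h1.resolve_left hA
    have h3 := h3.resolve_left hC
    have : e₁ * ((x₃ - x₁) * (v 0 - x₂ * v 1)) * (e₁ * e₂ * e₃ - 1) = 0 := by
      linear_combination e₃ * h1 - h3
    exact Or.inr (Or.inr (Or.inr (sub_eq_zero.1 ((mul_eq_zero.1 this).resolve_left
      (mul_ne_zero he₁0 (mul_ne_zero (sub_ne_zero.2 h13.symm) hB))))))
  · have hne : ∀ x : ℂ, ![x, 1] ≠ 0 := fun x h => one_ne_zero (congrFun h 1)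
    rintro (h | h | h | h)
    · refine ⟨![x₁, 1], hne _, (key _ (hne _)).2 ⟨Or.inl (by simp), Or.inr ?_, Or.inr ?_⟩⟩ <;>
        simp only [cons_val_zero, cons_val_one, h] <;> ring
    · refine ⟨![x₂, 1], hne _, (key _ (hne _)).2 ⟨Or.inr ?_, Or.inl (by simp), Or.inr ?_⟩⟩ <;>
        simp only [cons_val_zero, cons_val_one, h] <;> ring
    · refine ⟨![x₃, 1], hne _, (key _ (hne _)).2 ⟨Or.inr ?_, Or.inr ?_, Or.inl (by simp)⟩⟩ <;>
        simp only [cons_val_zero, cons_val_one, h] <;> ring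
    · -- the common zero of the three second linear forms
      obtain ⟨α, hα⟩ : ∃ α, α = e₂ * (e₁ ^ 2 - 1) := ⟨_, rfl⟩
      obtain ⟨β, hβ⟩ : ∃ β, β = e₂ - e₁ * e₃ := ⟨_, rfl⟩
      have hα0 : α ≠ 0 := by
        rw [hα, show e₁ ^ 2 - 1 = (e₁ - 1) * (e₁ - -1) by ring]
        exact mul_ne_zero he₂0 (mul_ne_zero (sub_ne_zero.2 he₁1) (sub_ne_zero.2 he₁m))
      have hv : ![α * (x₃ - x₁) * x₂ - β * (x₂ - x₃) * x₁,
          α * (x₃ - x₁) - β * (x₂ - x₃)] ≠ 0 := by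
        intro hz
        have hz0 := congrFun hz 0
        have hz1 := congrFun hz 1
        simp only [cons_val_zero, cons_val_one, Pi.zero_apply] at hz0 hz1
        refine mul_ne_zero hα0 (mul_ne_zero (sub_ne_zero.2 h13.symm) (sub_ne_zero.2 h12.symm)) ?_
        linear_combination hz0 - x₁ * hz1
      refine ⟨_, hv, (key _ hv).2 ⟨Or.inr ?_, Or.inr ?_, Or.inr ?_⟩⟩ <;>
        simp only [cons_val_zero, cons_val_one]
      · rw [hα, hβ]; ring
      · rw [hα, hβ]
        linear_combination e₂ * (e₃ - e₁ * e₂) * ((x₂ - x₃) * (x₃ - x₁) * (x₂ - x₁)) * h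
      · rw [hα, hβ]
        linear_combination -e₁ * (e₂ - e₁ * e₃) * ((x₂ - x₃) * (x₃ - x₁) * (x₂ - x₁)) * h
end

section
/- Let e₁, e₂, e₃ ∈ ℂ∖{0}, let x₁, x₂, x₃ ∈ ℂ be pairwise distinct, and let t₁ ∈ ℂ∖{0}. Let y₁ = (e₁²e₂x₂(x₁−x₃) + e₂x₃(x₂−x₁) + e₁e₃x₁(x₃−x₂)) / (e₁²e₂(x₁−x₃) + e₂(x₂−x₁) + e₁e₃(x₃−x₂)) (assume its denominator is nonzero). Define x₅ = ((x₂−y₁)t₁x₁ + (x₂−x₁)y₁) / ((x₂−y₁)t₁ + (x₂−x₁)) (assume its denominator is nonzero). Then x₅ = ((((e₁e₃−e₂)t₁+e₁e₃)x₁(x₂−x₃) + e₁²e₂x₂(x₃−x₁) + e₂x₃(x₁−x₂)) / (((e₁e₃−e₂)t₁+e₁e₃)(x₂−x₃) + e₁²e₂(x₃−x₁) + e₂(x₁−x₂)), assuming the latter denominator is nonzero. -/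
/-- the glued fixed point `x₅` (the image of `x₂` under
`M(√(−t₁); x₁, y₁)`) is given by the explicit rational formula in the
eigenvalue parameters, twist parameter and fixed points. -/
theorem glued_fixed_point_x5_formula
    (e₁ e₂ e₃ x₁ x₂ x₃ t₁ y₁ x₅ : ℂ)
    (he₁ : e₁ ≠ 0) (he₂ : e₂ ≠ 0) (he₃ : e₃ ≠ 0)
    (h12 : x₁ ≠ x₂) (h23 : x₂ ≠ x₃) (h13 : x₁ ≠ x₃)
    (ht₁ : t₁ ≠ 0)
    (hDy : e₁^2*e₂*(x₁-x₃) + e₂*(x₂-x₁) + e₁*e₃*(x₃-x₂) ≠ 0)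
    (hy₁ : y₁ = (e₁^2*e₂*x₂*(x₁-x₃) + e₂*x₃*(x₂-x₁) + e₁*e₃*x₁*(x₃-x₂)) /
               (e₁^2*e₂*(x₁-x₃) + e₂*(x₂-x₁) + e₁*e₃*(x₃-x₂)))
    (hDx₅ : (x₂-y₁)*t₁ + (x₂-x₁) ≠ 0)
    (hx₅ : x₅ = ((x₂-y₁)*t₁*x₁ + (x₂-x₁)*y₁) / ((x₂-y₁)*t₁ + (x₂-x₁)))
    (hD₅ : ((e₁*e₃-e₂)*t₁+e₁*e₃)*(x₂-x₃) + e₁^2*e₂*(x₃-x₁) + e₂*(x₁-x₂) ≠ 0) :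
    x₅ = (((e₁*e₃-e₂)*t₁+e₁*e₃)*x₁*(x₂-x₃) + e₁^2*e₂*x₂*(x₃-x₁) + e₂*x₃*(x₁-x₂)) /
         (((e₁*e₃-e₂)*t₁+e₁*e₃)*(x₂-x₃) + e₁^2*e₂*(x₃-x₁) + e₂*(x₁-x₂)) := by
  rw [eq_div_iff hDy] at hy₁
  rw [hx₅, div_eq_div_iff hDx₅ hD₅]
  linear_combination (x₁ - x₂) * (1 + t₁) * hy₁
end

section
/- Let e₁, e₂, e₃, e₄, e₅ ∈ ℂ∖{0}, let x₁, x₂, x₃ ∈ ℂ be pairwise distinct, and let t₁ ∈ ℂ∖{0}. Let y₁ = (e₁²e₂x₂(x₁−x₃) + e₂x₃(x₂−x₁) + e₁e₃x₁(x₃−x₂)) / (e₁²e₂(x₁−x₃) + e₂(x₂−x₁) + e₁e₃(x₃−x₂)), x₅ = (((e₁e₃−e₂)t₁+e₁e₃)x₁(x₂−x₃) + e₁²e₂x₂(x₃−x₁) + e₂x₃(x₁−x₂)) / (((e₁e₃−e₂)t₁+e₁e₃)(x₂−x₃) + e₁²e₂(x₃−x₁) + e₂(x₁−x₂)), and x₄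 = (e₁e₅x₅(x₁−y₁) + e₁²e₄x₁(y₁−x₅) + e₄y₁(x₅−x₁)) / (e₁e₅(x₁−y₁) + e₁²e₄(y₁−x₅) + e₄(x₅−x₁)), assuming all these denominators are nonzero. Then x₄ = a/b where a = e₁(−(e₁e₃−e₂)(e₁e₄−e₅)t₁ + e₃(e₁e₅−e₄))x₁(x₂−x₃) + e₁²e₂(e₁e₅−e₄)x₂(x₃−x₁) + e₂(e₁e₅−e₄)x₃(x₁−x₂) and b = e₁(−(e₁e₃−e₂)(e₁e₄−e₅)t₁ + e₃(e₁e₅−e₄))(x₂−x₃) + e₁²e₂(e₁e₅−e₄)(x₃−x₁) + e₂(e₁e₅−e₄)(x₁−x₂), assuming b ≠ 0. -/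
/-- the glued fixed point `x₄` of the four-holed sphere construction is
given by the explicit rational formula in the eigenvalue parameters `e₁,…,e₅`,
the twist parameter `t₁` and the fixed points `x₁,x₂,x₃`. -/
theorem glued_fixed_point_x4_formula
    (e₁ e₂ e₃ e₄ e₅ x₁ x₂ x₃ t₁ y₁ x₅ x₄ : ℂ)
    (he₁ : e₁ ≠ 0) (he₂ : e₂ ≠ 0) (he₃ : e₃ ≠ 0) (he₄ : e₄ ≠ 0) (he₅ : e₅ ≠ 0)
    (h12 : x₁ ≠ x₂) (h23 : x₂ ≠ x₃) (h13 : x₁ ≠ x₃)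
    (ht₁ : t₁ ≠ 0)
    (hDy : e₁^2*e₂*(x₁-x₃) + e₂*(x₂-x₁) + e₁*e₃*(x₃-x₂) ≠ 0)
    (hy₁ : y₁ = (e₁^2*e₂*x₂*(x₁-x₃) + e₂*x₃*(x₂-x₁) + e₁*e₃*x₁*(x₃-x₂)) /
               (e₁^2*e₂*(x₁-x₃) + e₂*(x₂-x₁) + e₁*e₃*(x₃-x₂)))
    (hD₅ : ((e₁*e₃-e₂)*t₁+e₁*e₃)*(x₂-x₃) + e₁^2*e₂*(x₃-x₁) + e₂*(x₁-x₂) ≠ 0)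
    (hx₅ : x₅ = (((e₁*e₃-e₂)*t₁+e₁*e₃)*x₁*(x₂-x₃) + e₁^2*e₂*x₂*(x₃-x₁) + e₂*x₃*(x₁-x₂)) /
               (((e₁*e₃-e₂)*t₁+e₁*e₃)*(x₂-x₃) + e₁^2*e₂*(x₃-x₁) + e₂*(x₁-x₂)))
    (hD₄ : e₁*e₅*(x₁-y₁) + e₁^2*e₄*(y₁-x₅) + e₄*(x₅-x₁) ≠ 0)
    (hx₄ : x₄ = (e₁*e₅*x₅*(x₁-y₁) + e₁^2*e₄*x₁*(y₁-x₅) + e₄*y₁*(x₅-x₁)) /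
               (e₁*e₅*(x₁-y₁) + e₁^2*e₄*(y₁-x₅) + e₄*(x₅-x₁)))
    (hb : e₁*(-(e₁*e₃-e₂)*(e₁*e₄-e₅)*t₁ + e₃*(e₁*e₅-e₄))*(x₂-x₃)
            + e₁^2*e₂*(e₁*e₅-e₄)*(x₃-x₁) + e₂*(e₁*e₅-e₄)*(x₁-x₂) ≠ 0) :
    x₄ = (e₁*(-(e₁*e₃-e₂)*(e₁*e₄-e₅)*t₁ + e₃*(e₁*e₅-e₄))*x₁*(x₂-x₃)
            + e₁^2*e₂*(e₁*e₅-e₄)*x₂*(x₃-x₁) + e₂*(e₁*e₅-e₄)*x₃*(x₁-x₂)) /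
         (e₁*(-(e₁*e₃-e₂)*(e₁*e₄-e₅)*t₁ + e₃*(e₁*e₅-e₄))*(x₂-x₃)
            + e₁^2*e₂*(e₁*e₅-e₄)*(x₃-x₁) + e₂*(e₁*e₅-e₄)*(x₁-x₂)) := by
  set Ny := e₁^2*e₂*x₂*(x₁-x₃) + e₂*x₃*(x₂-x₁) + e₁*e₃*x₁*(x₃-x₂) with hNy
  set Dy := e₁^2*e₂*(x₁-x₃) + e₂*(x₂-x₁) + e₁*e₃*(x₃-x₂) with hDy_def
  set T := (e₁*e₃-e₂)*t₁*(x₂-x₃) with hT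
  have hN₅ : ((e₁*e₃-e₂)*t₁+e₁*e₃)*x₁*(x₂-x₃) + e₁^2*e₂*x₂*(x₃-x₁) + e₂*x₃*(x₁-x₂)
      = T*x₁ - Ny := by rw [hT, hNy]; ring
  have hD₅_eq : ((e₁*e₃-e₂)*t₁+e₁*e₃)*(x₂-x₃) + e₁^2*e₂*(x₃-x₁) + e₂*(x₁-x₂)
      = T - Dy := by rw [hT, hDy_def]; ring
  have ha_eq : e₁*(-(e₁*e₃-e₂)*(e₁*e₄-e₅)*t₁ + e₃*(e₁*e₅-e₄))*x₁*(x₂-x₃)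
      + e₁^2*e₂*(e₁*e₅-e₄)*x₂*(x₃-x₁) + e₂*(e₁*e₅-e₄)*x₃*(x₁-x₂)
      = -(e₁*e₅-e₄)*Ny - e₁*(e₁*e₄-e₅)*T*x₁ := by rw [hT, hNy]; ring
  have hb_eq : e₁*(-(e₁*e₃-e₂)*(e₁*e₄-e₅)*t₁ + e₃*(e₁*e₅-e₄))*(x₂-x₃)
      + e₁^2*e₂*(e₁*e₅-e₄)*(x₃-x₁) + e₂*(e₁*e₅-e₄)*(x₁-x₂)
      = -(e₁*e₅-e₄)*Dy - e₁*(e₁*e₄-e₅)*T := by rw [hT, hDy_def]; ring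
  rw [hN₅, hD₅_eq] at hx₅
  rw [hD₅_eq] at hD₅
  rw [ha_eq, hb_eq]
  clear_value Ny Dy T
  have hden : e₁*e₅*(x₁-y₁) + e₁^2*e₄*(y₁-x₅) + e₄*(x₅-x₁)
      = (x₁*Dy - Ny) / (Dy*(T - Dy)) * (-(e₁*e₅-e₄)*Dy - e₁*(e₁*e₄-e₅)*T) := by
    rw [hy₁, hx₅]; field_simp; ring
  have hnum : e₁*e₅*x₅*(x₁-y₁) + e₁^2*e₄*x₁*(y₁-x₅) + e₄*y₁*(x₅-x₁)
      = (x₁*Dy - Ny) / (Dy*(T - Dy)) * (-(e₁*e₅-e₄)*Ny - e₁*(e₁*e₄-e₅)*T*x₁) := by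
    rw [hy₁, hx₅]; field_simp; ring
  rw [hden] at hD₄
  rw [hx₄, hnum, hden, mul_div_mul_left _ _ (left_ne_zero_of_mul hD₄)]
end

section
/- Let e₁, e₂, e₃, e₄, e₅ ∈ ℂ∖{0}, let x₁, x₂, x₃ ∈ ℂ be pairwise distinct, and let t₁ ∈ ℂ∖{0}. Define x₅ = (((e₁e₃−e₂)t₁+e₁e₃)x₁(x₂−x₃) + e₁²e₂x₂(x₃−x₁) + e₂x₃(x₁−x₂)) / (((e₁e₃−e₂)t₁+e₁e₃)(x₂−x₃) + e₁²e₂(x₃−x₁) + e₂(x₁−x₂)) and x₄ = (e₁(−(e₁e₃−e₂)(e₁e₄−e₅)t₁ + e₃(e₁e₅−e₄))x₁(x₂−x₃) + e₁²e₂(e₁e₅−e₄)x₂(x₃−x₁) + e₂(e₁e₅−e₄)x₃(x₁−x₂)) / (e₁(−(e₁e₃−e₂)(e₁e₄−e₅)t₁ + e₃(e₁e₅−e₄))(x₂−x₃) + e₁²e₂(e₁e₅−e₄)(x₃−x₁) + e₂(e₁e₅−e₄)(x₁−x₂)), assuming both denominators are nonzero. Assume further e₂ ≠ e₁e₃, e₄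 ≠ e₁e₅, e₁e₄ ≠ e₅, e₁e₂ ≠ e₃, and that the four points in each cross ratio below are pairwise distinct. Then: (i) t₁ = −1 + (e₂(1−e₁²)/(e₂−e₁e₃))·[x₅:x₃:x₁:x₂]; (ii) t₁ = −((e₁e₅−e₄)/(e₁(e₁e₄−e₅)))·(−1 + (e₂(1−e₁²)/(e₂−e₁e₃))·[x₄:x₃:x₁:x₂]); (iii) t₁⁻¹ = −1 + (e₄(1−e₁²)/(e₄−e₁e₅))·[x₂:x₄:x₁:x₅]; (iv) t₁⁻¹ = −((e₁e₃−e₂)/(e₁(e₁e₂−e₃)))·(−1 + (e₄(1−e₁²)/(e₄−e₁e₅))·[x₃:x₄:x₁:x₅]). -/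
/-- The cross ratio `[x₀:x₁:x₂:x₃]` of four points of `ℂ`. -/
noncomputable def crossRatio (x₀ x₁ x₂ x₃ : ℂ) : ℂ :=
  ((x₃ - x₀) / (x₃ - x₁)) * ((x₂ - x₁) / (x₂ - x₀))

/-- the twist parameter of the four-holed sphere gluing is recovered
from the fixed points by four cross-ratio formulas. -/
theorem twist_parameter_from_fixed_points
    (e₁ e₂ e₃ e₄ e₅ x₁ x₂ x₃ t₁ x₅ x₄ : ℂ)
    (he₁ : e₁ ≠ 0) (he₂ : e₂ ≠ 0) (he₃ : e₃ ≠ 0) (he₄ : e₄ ≠ 0) (he₅ : e₅ ≠ 0)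
    (h12 : x₁ ≠ x₂) (h23 : x₂ ≠ x₃) (h13 : x₁ ≠ x₃)
    (ht₁ : t₁ ≠ 0)
    (hD₅ : ((e₁*e₃-e₂)*t₁+e₁*e₃)*(x₂-x₃) + e₁^2*e₂*(x₃-x₁) + e₂*(x₁-x₂) ≠ 0)
    (hx₅ : x₅ = (((e₁*e₃-e₂)*t₁+e₁*e₃)*x₁*(x₂-x₃) + e₁^2*e₂*x₂*(x₃-x₁) + e₂*x₃*(x₁-x₂)) /
               (((e₁*e₃-e₂)*t₁+e₁*e₃)*(x₂-x₃) + e₁^2*e₂*(x₃-x₁) + e₂*(x₁-x₂)))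
    (hD₄ : e₁*(-(e₁*e₃-e₂)*(e₁*e₄-e₅)*t₁ + e₃*(e₁*e₅-e₄))*(x₂-x₃)
            + e₁^2*e₂*(e₁*e₅-e₄)*(x₃-x₁) + e₂*(e₁*e₅-e₄)*(x₁-x₂) ≠ 0)
    (hx₄ : x₄ = (e₁*(-(e₁*e₃-e₂)*(e₁*e₄-e₅)*t₁ + e₃*(e₁*e₅-e₄))*x₁*(x₂-x₃)
            + e₁^2*e₂*(e₁*e₅-e₄)*x₂*(x₃-x₁) + e₂*(e₁*e₅-e₄)*x₃*(x₁-x₂)) /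
         (e₁*(-(e₁*e₃-e₂)*(e₁*e₄-e₅)*t₁ + e₃*(e₁*e₅-e₄))*(x₂-x₃)
            + e₁^2*e₂*(e₁*e₅-e₄)*(x₃-x₁) + e₂*(e₁*e₅-e₄)*(x₁-x₂)))
    (hq₁ : e₂ ≠ e₁*e₃) (hq₂ : e₄ ≠ e₁*e₅) (hq₃ : e₁*e₄ ≠ e₅) (hq₄ : e₁*e₂ ≠ e₃)
    (h14 : x₁ ≠ x₄) (h15 : x₁ ≠ x₅) (h24 : x₂ ≠ x₄) (h25 : x₂ ≠ x₅)
    (h34 : x₃ ≠ x₄) (h35 : x₃ ≠ x₅) (h45 : x₄ ≠ x₅) :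
    t₁ = -1 + (e₂*(1-e₁^2)/(e₂-e₁*e₃)) * crossRatio x₅ x₃ x₁ x₂ ∧
    t₁ = -((e₁*e₅-e₄)/(e₁*(e₁*e₄-e₅))) *
          (-1 + (e₂*(1-e₁^2)/(e₂-e₁*e₃)) * crossRatio x₄ x₃ x₁ x₂) ∧
    t₁⁻¹ = -1 + (e₄*(1-e₁^2)/(e₄-e₁*e₅)) * crossRatio x₂ x₄ x₁ x₅ ∧
    t₁⁻¹ = -((e₁*e₃-e₂)/(e₁*(e₁*e₂-e₃))) *
          (-1 + (e₄*(1-e₁^2)/(e₄-e₁*e₅)) * crossRatio x₃ x₄ x₁ x₅) := by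
  set D₅ := ((e₁*e₃-e₂)*t₁+e₁*e₃)*(x₂-x₃) + e₁^2*e₂*(x₃-x₁) + e₂*(x₁-x₂) with hD₅_def
  set D₄ := e₁*(-(e₁*e₃-e₂)*(e₁*e₄-e₅)*t₁ + e₃*(e₁*e₅-e₄))*(x₂-x₃)
    + e₁^2*e₂*(e₁*e₅-e₄)*(x₃-x₁) + e₂*(e₁*e₅-e₄)*(x₁-x₂) with hD₄_def
  have h₅₁ : x₁ - x₅ = -(e₂*(x₃-x₁)*(x₁-x₂)*(1-e₁^2)) / D₅ := by
    rw [hx₅, eq_div_iff hD₅, sub_mul, div_mul_cancel₀ _ hD₅, hD₅_def]; ring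
  have h₅₂ : x₂ - x₅ = -((x₂-x₃)*(x₁-x₂)*((e₁*e₃-e₂)*(t₁+1))) / D₅ := by
    rw [hx₅, eq_div_iff hD₅, sub_mul, div_mul_cancel₀ _ hD₅, hD₅_def]; ring
  have h₅₃ : x₅ - x₃ = (x₂-x₃)*(x₃-x₁)*(e₁*(e₁*e₂-e₃)-(e₁*e₃-e₂)*t₁) / D₅ := by
    rw [hx₅, eq_div_iff hD₅, sub_mul, div_mul_cancel₀ _ hD₅, hD₅_def]; ring
  have h₄₁ : x₁ - x₄ = -((e₁*e₅-e₄)*e₂*(x₃-x₁)*(x₁-x₂)*(1-e₁^2)) / D₄ := by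
    rw [hx₄, eq_div_iff hD₄, sub_mul, div_mul_cancel₀ _ hD₄, hD₄_def]; ring
  have h₄₂ : x₂ - x₄ = -((x₂-x₃)*(x₁-x₂)*
      ((e₁*e₃-e₂)*((e₁*e₅-e₄)-e₁*(e₁*e₄-e₅)*t₁))) / D₄ := by
    rw [hx₄, eq_div_iff hD₄, sub_mul, div_mul_cancel₀ _ hD₄, hD₄_def]; ring
  have h₅₄ : x₅ - x₄ = e₂*(x₃-x₁)*(x₁-x₂)*(1-e₁^2)^2*(x₂-x₃)*((e₁*e₃-e₂)*t₁*e₄)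
      / (D₄*D₅) := by
    have h : x₅ - x₄ = (x₁ - x₄) - (x₁ - x₅) := by ring
    rw [h, h₄₁, h₅₁, div_sub_div _ _ hD₄ hD₅, hD₄_def, hD₅_def]; ring
  have hE : 1 - e₁^2 ≠ 0 := by
    intro h
    rw [h, mul_zero, neg_zero, zero_div] at h₅₁
    exact h15 (sub_eq_zero.mp h₅₁)
  clear_value D₄ D₅
  have hw : x₁ - x₂ ≠ 0 := sub_ne_zero.mpr h12
  have hu : x₂ - x₃ ≠ 0 := sub_ne_zero.mpr h23
  have hv : x₃ - x₁ ≠ 0 := sub_ne_zero.mpr h13.symm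
  have hq : e₁*e₃-e₂ ≠ 0 := sub_ne_zero.mpr hq₁.symm
  have hg : e₁*e₅-e₄ ≠ 0 := sub_ne_zero.mpr hq₂.symm
  have hp : e₁*e₄-e₅ ≠ 0 := sub_ne_zero.mpr hq₃
  have hr : e₁*e₂-e₃ ≠ 0 := sub_ne_zero.mpr hq₄
  have c₁ : crossRatio x₅ x₃ x₁ x₂ = -((e₁*e₃-e₂)*(t₁+1)) / (e₂*(1-e₁^2)) := by
    rw [crossRatio, h₅₁, h₅₂, ← neg_sub x₃ x₁]
    field_simp
  have c₂ : crossRatio x₄ x₃ x₁ x₂ =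
      -((e₁*e₃-e₂)*((e₁*e₅-e₄)-e₁*(e₁*e₄-e₅)*t₁)) / ((e₁*e₅-e₄)*e₂*(1-e₁^2)) := by
    rw [crossRatio, h₄₁, h₄₂, ← neg_sub x₃ x₁]
    field_simp
  have c₃ : crossRatio x₂ x₄ x₁ x₅ = -((t₁+1)*(e₁*e₅-e₄)) / (t₁*e₄*(1-e₁^2)) := by
    rw [crossRatio, h₅₄, h₄₁, ← neg_sub x₂ x₅, h₅₂]
    field_simp
  have c₄ : crossRatio x₃ x₄ x₁ x₅ =
      (e₁*(e₁*e₂-e₃)-(e₁*e₃-e₂)*t₁)*(e₁*e₅-e₄) / ((1-e₁^2)*(e₁*e₃-e₂)*t₁*e₄) := by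
    rw [crossRatio, h₅₄, h₄₁, h₅₃, ← neg_sub x₃ x₁]
    field_simp
  rw [c₁, c₂, c₃, c₄, ← neg_sub (e₁*e₃) e₂, ← neg_sub (e₁*e₅) e₄]
  refine ⟨?_, ?_, ?_, ?_⟩ <;> field_simp <;> ring
end

section
/- Let e₁, e₂, e₃ ∈ ℂ∖{0}, let x₁, x₂, x₃ ∈ ℂ be pairwise distinct, and let t₁ ∈ ℂ∖{0}. Define x₅ = (((e₁e₃−e₂)t₁+e₁e₃)x₁(x₂−x₃) + e₁²e₂x₂(x₃−x₁) + e₂x₃(x₁−x₂)) / (((e₁e₃−e₂)t₁+e₁e₃)(x₂−x₃) + e₁²e₂(x₃−x₁) + e₂(x₁−x₂)) and y₂ = (e₂²e₃x₃(x₂−x₁) + e₃x₁(x₃−x₂) + e₂e₁x₂(x₁−x₃)) / (e₂²e₃(x₂−x₁) + e₃(x₃−x₂) + e₂e₁(x₁−x₃)), assuming both denominators are nonzero. Assume also e₂⁻¹ ≠ e₁e₃, 1 ≠ e₁e₂e₃, e₁e₂ ≠ e₃, and that x₅, x₃, x₁, y₂ are pairwise distinct. Then −1 + ((e₂⁻¹(1−e₁²))/(e₂⁻¹−e₁e₃))·[x₅:x₃:x₁:y₂]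 = ((e₂e₃−e₁)/(1−e₁e₂e₃))·((e₁e₃−e₂)/(e₁e₂−e₃))·t₁. That is, replacing the eigenvalue parameter e₂ by e₂⁻¹ (and correspondingly the fixed point x₂ by the other fixed point y₂) changes the twist parameter t₁ to ((e₂e₃−e₁)(e₁e₃−e₂))/((1−e₁e₂e₃)(e₁e₂−e₃))·t₁. -/
/-- replacing the eigenvalue parameter `e₂` by `e₂⁻¹` (and the fixed
point `x₂` by the other fixed point `y₂`) multiplies the twist parameter `t₁` by
`((e₂e₃−e₁)(e₁e₃−e₂))/((1−e₁e₂e₃)(e₁e₂−e₃))`. -/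
theorem twist_parameter_change_e2_inverse
    (e₁ e₂ e₃ x₁ x₂ x₃ t₁ x₅ y₂ : ℂ)
    (he₁ : e₁ ≠ 0) (he₂ : e₂ ≠ 0) (he₃ : e₃ ≠ 0)
    (h12 : x₁ ≠ x₂) (h23 : x₂ ≠ x₃) (h13 : x₁ ≠ x₃)
    (ht₁ : t₁ ≠ 0)
    (hD₅ : ((e₁*e₃-e₂)*t₁+e₁*e₃)*(x₂-x₃) + e₁^2*e₂*(x₃-x₁) + e₂*(x₁-x₂) ≠ 0)
    (hx₅ : x₅ = (((e₁*e₃-e₂)*t₁+e₁*e₃)*x₁*(x₂-x₃) + e₁^2*e₂*x₂*(x₃-x₁) + e₂*x₃*(x₁-x₂)) /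
               (((e₁*e₃-e₂)*t₁+e₁*e₃)*(x₂-x₃) + e₁^2*e₂*(x₃-x₁) + e₂*(x₁-x₂)))
    (hDy₂ : e₂^2*e₃*(x₂-x₁) + e₃*(x₃-x₂) + e₂*e₁*(x₁-x₃) ≠ 0)
    (hy₂ : y₂ = (e₂^2*e₃*x₃*(x₂-x₁) + e₃*x₁*(x₃-x₂) + e₂*e₁*x₂*(x₁-x₃)) /
               (e₂^2*e₃*(x₂-x₁) + e₃*(x₃-x₂) + e₂*e₁*(x₁-x₃)))
    (hq₁ : e₂⁻¹ ≠ e₁*e₃) (hq₂ : e₁*e₂*e₃ ≠ 1) (hq₃ : e₁*e₂ ≠ e₃)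
    (h53 : x₅ ≠ x₃) (h51 : x₅ ≠ x₁) (h5y : x₅ ≠ y₂)
    (h31 : x₃ ≠ x₁) (h3y : x₃ ≠ y₂) (h1y : x₁ ≠ y₂) :
    -1 + ((e₂⁻¹*(1-e₁^2))/(e₂⁻¹-e₁*e₃)) * crossRatio x₅ x₃ x₁ y₂
      = ((e₂*e₃-e₁)/(1-e₁*e₂*e₃)) * ((e₁*e₃-e₂)/(e₁*e₂-e₃)) * t₁ := by
  have hy : y₂ * (e₂^2*e₃*(x₂-x₁) + e₃*(x₃-x₂) + e₂*e₁*(x₁-x₃))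
      = e₂^2*e₃*x₃*(x₂-x₁) + e₃*x₁*(x₃-x₂) + e₂*e₁*x₂*(x₁-x₃) := by
    rw [hy₂, div_mul_cancel₀ _ hDy₂]
  have hx : x₅ * (((e₁*e₃-e₂)*t₁+e₁*e₃)*(x₂-x₃) + e₁^2*e₂*(x₃-x₁) + e₂*(x₁-x₂))
      = ((e₁*e₃-e₂)*t₁+e₁*e₃)*x₁*(x₂-x₃) + e₁^2*e₂*x₂*(x₃-x₁) + e₂*x₃*(x₁-x₂) := by
    rw [hx₅, div_mul_cancel₀ _ hD₅]
  clear hx₅ hy₂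
  set D₅ := ((e₁*e₃-e₂)*t₁+e₁*e₃)*(x₂-x₃) + e₁^2*e₂*(x₃-x₁) + e₂*(x₁-x₂) with hD₅_def
  set Dy := e₂^2*e₃*(x₂-x₁) + e₃*(x₃-x₂) + e₂*e₁*(x₁-x₃) with hDy_def
  have hq₂' : 1 - e₁*e₂*e₃ ≠ 0 := sub_ne_zero.mpr hq₂.symm
  have hq₃' : e₁*e₂ - e₃ ≠ 0 := sub_ne_zero.mpr hq₃
  have h1 : x₂ - x₁ ≠ 0 := sub_ne_zero.mpr h12.symm
  have h2 : x₂ - x₃ ≠ 0 := sub_ne_zero.mpr h23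
  have h3 : x₁ - x₃ ≠ 0 := sub_ne_zero.mpr h13
  have hyx₃ : y₂ - x₃ = (x₁-x₃)*(x₂-x₃)*(e₁*e₂-e₃) / Dy := by
    rw [eq_div_iff hDy₂, sub_mul, hy, hDy_def]; ring
  have hx₁x₅ : x₁ - x₅ = e₂*(1-e₁^2)*(x₁-x₃)*(x₁-x₂) / D₅ := by
    rw [eq_div_iff hD₅, sub_mul, hx, hD₅_def]; ring
  have hyx₅ : y₂ - x₅ = e₂*(x₂-x₃)*(x₂-x₁)*(x₃-x₁)
      * ((1-e₁*e₂*e₃)*(e₁*e₂-e₃) + (e₂*e₃-e₁)*(e₁*e₃-e₂)*t₁) / (Dy*D₅) := by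
    rw [eq_div_iff (mul_ne_zero hDy₂ hD₅),
      show (y₂ - x₅) * (Dy*D₅) = (y₂*Dy)*D₅ - (x₅*D₅)*Dy by ring, hy, hx, hD₅_def, hDy_def]
    ring
  have he : 1 - e₁^2 ≠ 0 := by
    intro h
    apply h51
    rw [h] at hx₁x₅
    linear_combination -hx₁x₅
  have hcoef : e₂⁻¹*(1-e₁^2)/(e₂⁻¹-e₁*e₃) = (1-e₁^2)/(1-e₁*e₂*e₃) := by
    rw [show e₂⁻¹-e₁*e₃ = e₂⁻¹*(1-e₁*e₂*e₃) by field_simp,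
      mul_div_mul_left _ _ (inv_ne_zero he₂)]
  have hcr : crossRatio x₅ x₃ x₁ y₂
      = ((1-e₁*e₂*e₃)*(e₁*e₂-e₃) + (e₂*e₃-e₁)*(e₁*e₃-e₂)*t₁)
        / ((e₁*e₂-e₃)*(1-e₁^2)) := by
    have h1' : x₁ - x₂ ≠ 0 := sub_ne_zero.mpr h12
    rw [crossRatio, hyx₅, hyx₃, hx₁x₅]
    clear_value D₅ Dy
    field_simp
    ring
  rw [hcoef, hcr]
  field_simp
  ring
end

section
/- Let e₁, e₂, e₃, e₄, e₅ ∈ ℂ∖{0} with e₁ ≠ ±1, let x₁, x₂, x₃ ∈ ℂ be pairwise distinct, and let t₁ ∈ ℂ∖{0}. Define x₅ = (((e₁e₃−e₂)t₁+e₁e₃)x₁(x₂−x₃) + e₁²e₂x₂(x₃−x₁) + e₂x₃(x₁−x₂)) / (((e₁e₃−e₂)t₁+e₁e₃)(x₂−x₃) + e₁²e₂(x₃−x₁) + e₂(x₁−x₂)) and x₄ = (e₁(−(e₁e₃−e₂)(e₁e₄−e₅)t₁ + e₃(e₁e₅−e₄))x₁(x₂−x₃) + e₁²e₂(e₁e₅−e₄)x₂(x₃−x₁)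 + e₂(e₁e₅−e₄)x₃(x₁−x₂)) / (e₁(−(e₁e₃−e₂)(e₁e₄−e₅)t₁ + e₃(e₁e₅−e₄))(x₂−x₃) + e₁²e₂(e₁e₅−e₄)(x₃−x₁) + e₂(e₁e₅−e₄)(x₁−x₂)), assuming both denominators are nonzero. Assume also e₄ ≠ e₁⁻¹e₅, e₁e₃ ≠ e₂, e₁e₄ ≠ e₅, and that x₃, x₅, x₁, x₄ are pairwise distinct. Then −1 + ((e₄(1−e₁⁻²))/(e₄−e₁⁻¹e₅))·[x₃:x₅:x₁:x₄] = ((e₁e₂−e₃)(e₁e₅−e₄))/((e₁e₃−e₂)(e₁e₄−e₅))·t₁⁻¹. That is, reversing the orientation of the dual edge replaces the parameters (e₁, t₁) by (e₁⁻¹, ((e₁e₂−e₃)(e₁e₅−e₄))/((e₁e₃−e₂)(e₁e₄−e₅))·t₁⁻¹). -/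
/-- reversing the orientation of the dual edge replaces `(e₁, t₁)` by
`(e₁⁻¹, ((e₁e₂−e₃)(e₁e₅−e₄))/((e₁e₃−e₂)(e₁e₄−e₅))·t₁⁻¹)`. -/
theorem twist_parameter_reverse_orientation
    (e₁ e₂ e₃ e₄ e₅ x₁ x₂ x₃ t₁ x₅ x₄ : ℂ)
    (he₁ : e₁ ≠ 0) (he₂ : e₂ ≠ 0) (he₃ : e₃ ≠ 0) (he₄ : e₄ ≠ 0) (he₅ : e₅ ≠ 0)
    (he₁1 : e₁ ≠ 1) (he₁m : e₁ ≠ -1)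
    (h12 : x₁ ≠ x₂) (h23 : x₂ ≠ x₃) (h13 : x₁ ≠ x₃)
    (ht₁ : t₁ ≠ 0)
    (hD₅ : ((e₁*e₃-e₂)*t₁+e₁*e₃)*(x₂-x₃) + e₁^2*e₂*(x₃-x₁) + e₂*(x₁-x₂) ≠ 0)
    (hx₅ : x₅ = (((e₁*e₃-e₂)*t₁+e₁*e₃)*x₁*(x₂-x₃) + e₁^2*e₂*x₂*(x₃-x₁) + e₂*x₃*(x₁-x₂)) /
               (((e₁*e₃-e₂)*t₁+e₁*e₃)*(x₂-x₃) + e₁^2*e₂*(x₃-x₁) + e₂*(x₁-x₂)))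
    (hD₄ : e₁*(-(e₁*e₃-e₂)*(e₁*e₄-e₅)*t₁ + e₃*(e₁*e₅-e₄))*(x₂-x₃)
            + e₁^2*e₂*(e₁*e₅-e₄)*(x₃-x₁) + e₂*(e₁*e₅-e₄)*(x₁-x₂) ≠ 0)
    (hx₄ : x₄ = (e₁*(-(e₁*e₃-e₂)*(e₁*e₄-e₅)*t₁ + e₃*(e₁*e₅-e₄))*x₁*(x₂-x₃)
            + e₁^2*e₂*(e₁*e₅-e₄)*x₂*(x₃-x₁) + e₂*(e₁*e₅-e₄)*x₃*(x₁-x₂)) /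
         (e₁*(-(e₁*e₃-e₂)*(e₁*e₄-e₅)*t₁ + e₃*(e₁*e₅-e₄))*(x₂-x₃)
            + e₁^2*e₂*(e₁*e₅-e₄)*(x₃-x₁) + e₂*(e₁*e₅-e₄)*(x₁-x₂)))
    (hq₁ : e₄ ≠ e₁⁻¹*e₅) (hq₂ : e₁*e₃ ≠ e₂) (hq₃ : e₁*e₄ ≠ e₅)
    (h35 : x₃ ≠ x₅) (h31 : x₃ ≠ x₁) (h34 : x₃ ≠ x₄)
    (h51 : x₅ ≠ x₁) (h54 : x₅ ≠ x₄) (h14 : x₁ ≠ x₄) :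
    -1 + ((e₄*(1-(e₁⁻¹)^2))/(e₄-e₁⁻¹*e₅)) * crossRatio x₃ x₅ x₁ x₄
      = ((e₁*e₂-e₃)*(e₁*e₅-e₄))/((e₁*e₃-e₂)*(e₁*e₄-e₅)) * t₁⁻¹ := by
  have hs : e₁ ^ 2 - 1 ≠ 0 := by
    rw [show e₁ ^ 2 - 1 = (e₁ - 1) * (e₁ + 1) by ring]
    exact mul_ne_zero (sub_ne_zero.2 he₁1) fun h => he₁m (eq_neg_of_add_eq_zero_left h)
  have ha := sub_ne_zero.2 hq₂
  have hb := sub_ne_zero.2 hq₃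
  have d₁₃ : x₁ - x₃ ≠ 0 := sub_ne_zero.2 h13
  have d₄₃ : x₄ - x₃ = (x₂ - x₃) * (x₃ - x₁) * (e₁ ^ 2 * e₂ * (e₁ * e₅ - e₄)
      - e₁ * (-(e₁ * e₃ - e₂) * (e₁ * e₄ - e₅) * t₁ + e₃ * (e₁ * e₅ - e₄))) /
      (e₁*(-(e₁*e₃-e₂)*(e₁*e₄-e₅)*t₁ + e₃*(e₁*e₅-e₄))*(x₂-x₃)
        + e₁^2*e₂*(e₁*e₅-e₄)*(x₃-x₁) + e₂*(e₁*e₅-e₄)*(x₁-x₂)) := by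
    rw [hx₄, eq_div_iff hD₄, sub_mul, div_mul_cancel₀ _ hD₄]
    ring
  have d₁₅ : x₁ - x₅ = e₂ * (x₃ - x₁) * (x₁ - x₂) * (e₁ ^ 2 - 1) /
      (((e₁*e₃-e₂)*t₁+e₁*e₃)*(x₂-x₃) + e₁^2*e₂*(x₃-x₁) + e₂*(x₁-x₂)) := by
    rw [hx₅, eq_div_iff hD₅, sub_mul, div_mul_cancel₀ _ hD₅]
    ring
  have d₁₄ : x₁ - x₄ = (e₁ * e₅ - e₄) * (e₂ * (x₃ - x₁) * (x₁ - x₂) * (e₁ ^ 2 - 1)) /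
      (e₁*(-(e₁*e₃-e₂)*(e₁*e₄-e₅)*t₁ + e₃*(e₁*e₅-e₄))*(x₂-x₃)
        + e₁^2*e₂*(e₁*e₅-e₄)*(x₃-x₁) + e₂*(e₁*e₅-e₄)*(x₁-x₂)) := by
    rw [hx₄, eq_div_iff hD₄, sub_mul, div_mul_cancel₀ _ hD₄]
    ring
  have d₄₅ : x₄ - x₅ = -(e₂ * (x₃ - x₁) * (x₁ - x₂) * (e₁ ^ 2 - 1) *
      ((x₂ - x₃) * t₁ * (e₁ * e₃ - e₂) * e₄ * (e₁ ^ 2 - 1))) /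
      ((e₁*(-(e₁*e₃-e₂)*(e₁*e₄-e₅)*t₁ + e₃*(e₁*e₅-e₄))*(x₂-x₃)
        + e₁^2*e₂*(e₁*e₅-e₄)*(x₃-x₁) + e₂*(e₁*e₅-e₄)*(x₁-x₂)) *
      (((e₁*e₃-e₂)*t₁+e₁*e₃)*(x₂-x₃) + e₁^2*e₂*(x₃-x₁) + e₂*(x₁-x₂))) := by
    rw [show x₄ - x₅ = (x₁ - x₅) - (x₁ - x₄) by ring, d₁₅, d₁₄, div_sub_div _ _ hD₅ hD₄,
      div_eq_div_iff (mul_ne_zero hD₅ hD₄) (mul_ne_zero hD₄ hD₅)]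
    ring
  have hcr : crossRatio x₃ x₅ x₁ x₄ = (e₁ ^ 2 * e₂ * (e₁ * e₅ - e₄)
      - e₁ * (-(e₁ * e₃ - e₂) * (e₁ * e₄ - e₅) * t₁ + e₃ * (e₁ * e₅ - e₄))) /
      (t₁ * (e₁ * e₃ - e₂) * e₄ * (e₁ ^ 2 - 1)) := by
    rw [crossRatio, div_mul_div_comm, div_eq_div_iff
      (mul_ne_zero (sub_ne_zero.2 h54.symm) d₁₃)
      (mul_ne_zero (mul_ne_zero (mul_ne_zero ht₁ ha) he₄) hs), d₄₃, d₁₅, d₄₅]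
    generalize e₁*(-(e₁*e₃-e₂)*(e₁*e₄-e₅)*t₁ + e₃*(e₁*e₅-e₄))*(x₂-x₃)
      + e₁^2*e₂*(e₁*e₅-e₄)*(x₃-x₁) + e₂*(e₁*e₅-e₄)*(x₁-x₂) = D₄ at hD₄ ⊢
    generalize ((e₁*e₃-e₂)*t₁+e₁*e₃)*(x₂-x₃) + e₁^2*e₂*(x₃-x₁) + e₂*(x₁-x₂) = D₅ at hD₅ ⊢
    field_simp
    ring
  have hcoef : e₄ * (1 - (e₁⁻¹) ^ 2) / (e₄ - e₁⁻¹ * e₅) =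
      e₄ * (e₁ ^ 2 - 1) / (e₁ * (e₁ * e₄ - e₅)) := by
    rw [div_eq_div_iff (sub_ne_zero.2 hq₁) (mul_ne_zero he₁ hb)]
    field_simp
  rw [hcr, hcoef]
  generalize e₁ * e₄ - e₅ = b at hb ⊢
  field_simp
  ring
end

section
/- Let e₁, e₂, e₃, e₄, e₅ ∈ ℂ∖{0} with e₁ ≠ ±1, let x₁, x₂, x₃ ∈ ℂ be pairwise distinct, and let t₁ ∈ ℂ∖{0}. Define x₅ and x₄ by the four-holed sphere gluing formulas (as in the context), assuming their denominators are nonzero. Assume also e₄ ≠ e₁e₅, e₁e₂ ≠ e₃, e₁e₃ ≠ e₂, and that x₂, x₄, x₁, x₅ are pairwise distinct. Define t₁′ by (t₁′)⁻¹ = −((e₁e₂−e₃)/(e₁(e₁e₃−e₂)))·(−1 + (e₄(1−e₁²)/(e₄−e₁e₅))·[x₂:x₄:x₁:x₅]). Then t₁′ = −(e₁(e₁e₃−e₂)/(e₁e₂−e₃))·t₁; that is, the right half-twist of the dual graph at a vertex changes the twist parameter t₁ to −e₁(e₁e₃−e₂)/(e₁e₂−e₃)·t₁. -/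
/-- the right half-twist of the dual graph at a vertex changes the
twist parameter `t₁` to `−e₁(e₁e₃−e₂)/(e₁e₂−e₃)·t₁`. -/
theorem twist_parameter_half_twist
    (e₁ e₂ e₃ e₄ e₅ x₁ x₂ x₃ t₁ x₅ x₄ t₁' : ℂ)
    (he₁ : e₁ ≠ 0) (he₂ : e₂ ≠ 0) (he₃ : e₃ ≠ 0) (he₄ : e₄ ≠ 0) (he₅ : e₅ ≠ 0)
    (he₁1 : e₁ ≠ 1) (he₁m : e₁ ≠ -1)
    (h12 : x₁ ≠ x₂) (h23 : x₂ ≠ x₃) (h13 : x₁ ≠ x₃)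
    (ht₁ : t₁ ≠ 0)
    (hD₅ : ((e₁*e₃-e₂)*t₁+e₁*e₃)*(x₂-x₃) + e₁^2*e₂*(x₃-x₁) + e₂*(x₁-x₂) ≠ 0)
    (hx₅ : x₅ = (((e₁*e₃-e₂)*t₁+e₁*e₃)*x₁*(x₂-x₃) + e₁^2*e₂*x₂*(x₃-x₁) + e₂*x₃*(x₁-x₂)) /
               (((e₁*e₃-e₂)*t₁+e₁*e₃)*(x₂-x₃) + e₁^2*e₂*(x₃-x₁) + e₂*(x₁-x₂)))
    (hD₄ : e₁*(-(e₁*e₃-e₂)*(e₁*e₄-e₅)*t₁ + e₃*(e₁*e₅-e₄))*(x₂-x₃)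
            + e₁^2*e₂*(e₁*e₅-e₄)*(x₃-x₁) + e₂*(e₁*e₅-e₄)*(x₁-x₂) ≠ 0)
    (hx₄ : x₄ = (e₁*(-(e₁*e₃-e₂)*(e₁*e₄-e₅)*t₁ + e₃*(e₁*e₅-e₄))*x₁*(x₂-x₃)
            + e₁^2*e₂*(e₁*e₅-e₄)*x₂*(x₃-x₁) + e₂*(e₁*e₅-e₄)*x₃*(x₁-x₂)) /
         (e₁*(-(e₁*e₃-e₂)*(e₁*e₄-e₅)*t₁ + e₃*(e₁*e₅-e₄))*(x₂-x₃)
            + e₁^2*e₂*(e₁*e₅-e₄)*(x₃-x₁) + e₂*(e₁*e₅-e₄)*(x₁-x₂)))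
    (hq₁ : e₄ ≠ e₁*e₅) (hq₂ : e₁*e₂ ≠ e₃) (hq₃ : e₁*e₃ ≠ e₂)
    (h24 : x₂ ≠ x₄) (h21 : x₂ ≠ x₁) (h25 : x₂ ≠ x₅)
    (h41 : x₄ ≠ x₁) (h45 : x₄ ≠ x₅) (h15 : x₁ ≠ x₅)
    (ht₁' : t₁'⁻¹ = -((e₁*e₂-e₃)/(e₁*(e₁*e₃-e₂))) *
          (-1 + (e₄*(1-e₁^2)/(e₄-e₁*e₅)) * crossRatio x₂ x₄ x₁ x₅)) :
    t₁' = -(e₁*(e₁*e₃-e₂)/(e₁*e₂-e₃)) * t₁ := by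
  have hP : e₁*e₃-e₂ ≠ 0 := sub_ne_zero.mpr hq₃
  have hQ : e₁*e₂-e₃ ≠ 0 := sub_ne_zero.mpr hq₂
  have hq : e₄-e₁*e₅ ≠ 0 := sub_ne_zero.mpr hq₁
  have hR : 1-e₁^2 ≠ 0 := by
    intro h
    have h' : (e₁-1)*(e₁+1) = 0 := by linear_combination -h
    rcases mul_eq_zero.mp h' with h' | h'
    · exact he₁1 (sub_eq_zero.mp h')
    · exact he₁m (eq_neg_of_add_eq_zero_left h')
  have hx12 : x₁-x₂ ≠ 0 := sub_ne_zero.mpr h12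
  have hx23 : x₂-x₃ ≠ 0 := sub_ne_zero.mpr h23
  have hx31 : x₃-x₁ ≠ 0 := sub_ne_zero.mpr h13.symm
  set D₅ := ((e₁*e₃-e₂)*t₁+e₁*e₃)*(x₂-x₃) + e₁^2*e₂*(x₃-x₁) + e₂*(x₁-x₂) with hD₅_def
  set D₄ := e₁*(-(e₁*e₃-e₂)*(e₁*e₄-e₅)*t₁ + e₃*(e₁*e₅-e₄))*(x₂-x₃)
    + e₁^2*e₂*(e₁*e₅-e₄)*(x₃-x₁) + e₂*(e₁*e₅-e₄)*(x₁-x₂) with hD₄_def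
  have h52 : x₅-x₂ = (e₁*e₃-e₂)*(t₁+1)*(x₂-x₃)*(x₁-x₂)/D₅ := by
    rw [hx₅, div_sub' hD₅]
    congr 1
    rw [hD₅_def]
    ring
  have h14 : x₁-x₄ = e₂*(1-e₁^2)*(e₄-e₁*e₅)*(x₃-x₁)*(x₁-x₂)/D₄ := by
    rw [hx₄, sub_div' hD₄]
    congr 1
    rw [hD₄_def]
    ring
  have h54 : x₅-x₄ =
      (e₁*e₃-e₂)*e₂*(1-e₁^2)^2*e₄*t₁*(x₂-x₃)*(x₃-x₁)*(x₁-x₂)/(D₅*D₄) := by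
    rw [hx₅, hx₄, div_sub_div _ _ hD₅ hD₄]
    congr 1
    rw [hD₅_def, hD₄_def]
    ring
  have hcross : e₄*(1-e₁^2)/(e₄-e₁*e₅) * crossRatio x₂ x₄ x₁ x₅ = (t₁+1)/t₁ := by
    rw [crossRatio, h52, h14, h54]
    field_simp
  rw [hcross] at ht₁'
  rw [← inv_inj, ht₁']
  field_simp
  ring
end

section
/- Let e₁ ∈ ℂ∖{0, 1, −1}, e₂ ∈ ℂ∖{0}, t₁ ∈ ℂ∖{0}, and let s ∈ ℂ with s² = −e₂t₁ (so s ≠ 0). Define A = [[e₁, e₁⁻¹ − e₁⁻¹e₂⁻¹],[0, e₁⁻¹]], D = [[e₂⁻¹, 0],[e₁² − e₂, e₂]], and B = (1/(s(e₁²−1)))·[[(e₂−e₁²)t₁ + (e₂−1), (t₁+1)(1−e₂)],[−e₂(e₁²−1), e₂(e₁²−1)]]. Then det B = 1 and B⁻¹A⁻¹BA = D⁻¹. -/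
open Matrix

/-- the explicit matrices `A = ρ(α₁)`, `B = ρ(β₁)`, `D = ρ(δ₁)` of the
parametrized one-holed torus representation satisfy `det B = 1` and the relation
`B⁻¹A⁻¹BA = D⁻¹`. -/
theorem one_holed_torus_relation
    (e₁ e₂ t₁ s : ℂ)
    (he₁ : e₁ ≠ 0) (he₁1 : e₁ ≠ 1) (he₁m : e₁ ≠ -1)
    (he₂ : e₂ ≠ 0) (ht₁ : t₁ ≠ 0) (hs : s^2 = -e₂*t₁) :
    let A : Matrix (Fin 2) (Fin 2) ℂ := !![e₁, e₁⁻¹ - e₁⁻¹*e₂⁻¹; 0, e₁⁻¹]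
    let D : Matrix (Fin 2) (Fin 2) ℂ := !![e₂⁻¹, 0; e₁^2 - e₂, e₂]
    let B : Matrix (Fin 2) (Fin 2) ℂ :=
      (1/(s*(e₁^2-1))) •
        !![(e₂-e₁^2)*t₁ + (e₂-1), (t₁+1)*(1-e₂);
           -e₂*(e₁^2-1), e₂*(e₁^2-1)]
    B.det = 1 ∧ B⁻¹ * A⁻¹ * B * A = D⁻¹ := by
  intro A D B
  have hd : e₁ ^ 2 - 1 ≠ 0 := by
    rw [show e₁ ^ 2 - 1 = (e₁ - 1) * (e₁ - -1) by ring]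
    exact mul_ne_zero (sub_ne_zero.mpr he₁1) (sub_ne_zero.mpr he₁m)
  have hs0 : s ≠ 0 := by
    rintro rfl
    have : e₂ * t₁ = 0 := by linear_combination hs
    exact mul_ne_zero he₂ ht₁ this
  have hdetB : B.det = 1 := by
    simp only [B, det_smul, det_fin_two_of, Fintype.card_fin]
    field_simp
    rw [hs]
    ring
  have hdetA : A.det = 1 := by
    simp [A, det_fin_two_of, he₁]
  have hD : D⁻¹ = !![e₂, 0; e₂ - e₁ ^ 2, e₂⁻¹] := by
    apply inv_eq_right_inv
    ext i j
    fin_cases i <;> fin_cases j <;> simp [D, mul_apply, Fin.sum_univ_two, he₂]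
    ring
  have hcomm : B * A = A * (B * D⁻¹) := by
    rw [hD]
    simp only [B, smul_mul_assoc, mul_smul_comm]
    congr 1
    ext i j
    fin_cases i <;> fin_cases j <;> simp [A, mul_apply, Fin.sum_univ_two] <;>
      field_simp <;> ring
  refine ⟨hdetB, ?_⟩
  rw [Matrix.mul_assoc, hcomm, Matrix.mul_assoc,
    nonsing_inv_mul_cancel_left A _ (by simp [hdetA]),
    nonsing_inv_mul_cancel_left B _ (by simp [hdetB])]
end

section
/- Let e₁ ∈ ℂ∖{0, 1, −1}, e₂ ∈ ℂ∖{0} with e₁² ≠ e₂, t₁ ∈ ℂ∖{0}, and let s ∈ ℂ with s² = −e₂t₁. Define A = [[e₁, e₁⁻¹ − e₁⁻¹e₂⁻¹],[0, e₁⁻¹]] and B = (1/(s(e₁²−1)))·[[(e₂−e₁²)t₁ + (e₂−1), (t₁+1)(1−e₂)],[−e₂(e₁²−1), e₂(e₁²−1)]]. Then t₁ = (−e₂/(e₁²−e₂)²)·(tr(B) − e₁·tr(AB))². -/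
open Matrix

/-- the twist parameter of the one-holed torus is recovered from the
trace functions `tr(ρ(β₁))` and `tr(ρ(α₁β₁))` by
`t₁ = (−e₂/(e₁²−e₂)²)·(tr(B) − e₁·tr(AB))²`. -/
theorem one_holed_torus_twist_from_traces
    (e₁ e₂ t₁ s : ℂ)
    (he₁ : e₁ ≠ 0) (he₁1 : e₁ ≠ 1) (he₁m : e₁ ≠ -1)
    (he₂ : e₂ ≠ 0) (hee : e₁^2 ≠ e₂) (ht₁ : t₁ ≠ 0) (hs : s^2 = -e₂*t₁) :
    let A : Matrix (Fin 2) (Fin 2) ℂ := !![e₁, e₁⁻¹ - e₁⁻¹*e₂⁻¹; 0, e₁⁻¹]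
    let B : Matrix (Fin 2) (Fin 2) ℂ :=
      (1/(s*(e₁^2-1))) •
        !![(e₂-e₁^2)*t₁ + (e₂-1), (t₁+1)*(1-e₂);
           -e₂*(e₁^2-1), e₂*(e₁^2-1)]
    t₁ = (-e₂/(e₁^2-e₂)^2) * (Matrix.trace B - e₁ * Matrix.trace (A * B))^2 := by
  intro A B
  have hs0 : s ≠ 0 := by
    rintro rfl
    exact mul_ne_zero (neg_ne_zero.mpr he₂) ht₁ (by simpa using hs.symm)
  have h1 : e₁^2 - 1 ≠ 0 := by
    have h : e₁^2 - 1 = (e₁ - 1) * (e₁ - (-1)) := by ring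
    rw [h]
    exact mul_ne_zero (sub_ne_zero.mpr he₁1) (sub_ne_zero.mpr he₁m)
  have h2 : e₁^2 - e₂ ≠ 0 := sub_ne_zero.mpr hee
  have key : Matrix.trace B - e₁ * Matrix.trace (A * B) = (e₁^2 - e₂) * t₁ / s := by
    simp only [A, B, Matrix.trace_fin_two, Matrix.mul_apply, Fin.sum_univ_two,
      Matrix.smul_apply, Matrix.of_apply, Matrix.cons_val', Matrix.cons_val_zero,
      Matrix.cons_val_one, Matrix.cons_val_fin_one, smul_eq_mul]
    field_simp
    ring
  rw [key, div_pow, hs]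
  field_simp
end

section
/- Let e₁ ∈ ℂ∖{0, 1, −1}, t₁ ∈ ℂ∖{0}, and let u ∈ ℂ with u² = t₁. Define A = [[e₁, 2e₁⁻¹],[0, e₁⁻¹]] and B = (1/(u(e₁²−1)))·[[(e₁²+1)t₁ + 2, −2(t₁+1)],[−e₁²+1, e₁²−1]]. Then tr(A)² + tr(B)² + tr(AB)² − tr(A)·tr(B)·tr(AB) = 0 (the Markov identity). -/
open Matrix

/-- for the one-holed torus with boundary eigenvalue parameter
`e₂ = −1`, the traces of `A = ρ(α₁)`, `B = ρ(β₁)` and `AB` satisfy the Markov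
identity `tr(A)² + tr(B)² + tr(AB)² − tr(A)tr(B)tr(AB) = 0`. -/
theorem one_holed_torus_markov_identity
    (e₁ t₁ u : ℂ)
    (he₁ : e₁ ≠ 0) (he₁1 : e₁ ≠ 1) (he₁m : e₁ ≠ -1)
    (ht₁ : t₁ ≠ 0) (hu : u^2 = t₁) :
    let A : Matrix (Fin 2) (Fin 2) ℂ := !![e₁, 2*e₁⁻¹; 0, e₁⁻¹]
    let B : Matrix (Fin 2) (Fin 2) ℂ :=
      (1/(u*(e₁^2-1))) •
        !![(e₁^2+1)*t₁ + 2, -2*(t₁+1);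
           -e₁^2+1, e₁^2-1]
    (Matrix.trace A)^2 + (Matrix.trace B)^2 + (Matrix.trace (A*B))^2
      - Matrix.trace A * Matrix.trace B * Matrix.trace (A*B) = 0 := by
  subst hu
  intro A B
  have hu₀ : u ≠ 0 := by
    rintro rfl
    simp at ht₁
  have hd : e₁ ^ 2 - 1 ≠ 0 := by
    simp [sub_eq_zero, he₁1, he₁m]
  have hA : trace A = (e₁ ^ 2 + 1) / e₁ := by
    simp only [A, trace_fin_two_of]
    field_simp
  have hB : trace B = (e₁ ^ 2 + 1) * (u ^ 2 + 1) / (u * (e₁ ^ 2 - 1)) := by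
    simp only [B, trace_smul, trace_fin_two_of, smul_eq_mul]
    field_simp
    ring
  have hAB : trace (A * B) =
      (e₁ ^ 2 + 1) * (e₁ ^ 2 * u ^ 2 + 1) / (e₁ * (u * (e₁ ^ 2 - 1))) := by
    simp only [A, B, Matrix.mul_smul, trace_smul, trace_fin_two, mul_apply,
      Fin.sum_univ_two, of_apply, cons_val', cons_val_zero, cons_val_one, cons_val_fin_one, smul_eq_mul]
    field_simp
    ring
  rw [hA, hB, hAB]
  field_simp
  ring
end

section
/- Let e₁, e₂, e₃ ∈ ℂ∖{0} and let x₁, x₂, x₃ ∈ ℂ be pairwise distinct. Let P₁ be the pants matrix associated to (e₁,e₂,e₃,x₁,x₂,x₃) with index i = 1, and let w be the image of x₂ under the Möbius action of P₁ (assume the corresponding denominator is nonzero and that w, x₁, x₂, x₃ are such that the cross ratio below is defined, i.e. x₃, x₁, w, x₂ are pairwise distinct). Then [x₃:x₁:w:x₂] = e₂/(e₃e₁). That is, the complex (exponential shear-bend) parameter of the edge of the ideal triangulation of the pair of pants spiralling around the boundary curves c₁ and c₃ equals e₂/(e₁e₃). -/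
open Matrix

/-- The denominator of the image of `v` under the Möbius action of the pants matrix. -/
lemma pantsMatrix_den (a b c u v w : ℂ) (huv : v - u ≠ 0) :
    pantsMatrix a b c u v w 1 0 * v + pantsMatrix a b c u v w 1 1
      = (b * (v - u) + a * c * (w - v)) / (a * b * (w - u)) := by
  rw [← mul_div_mul_right _ (a * b * (w - u)) huv]
  simp [pantsMatrix, div_eq_mul_inv]
  ring

/-- The numerator of the image of `v` under the Möbius action of the pants matrix. -/
lemma pantsMatrix_num (a b c u v w : ℂ) (huv : v - u ≠ 0) :
    pantsMatrix a b c u v w 0 0 * v + pantsMatrix a b c u v w 0 1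
      = (b * w * (v - u) + a * c * u * (w - v)) / (a * b * (w - u)) := by
  rw [← mul_div_mul_right _ (a * b * (w - u)) huv]
  simp [pantsMatrix, div_eq_mul_inv]
  ring

/-- the exponential shear-bend parameter of the edge of the ideal
triangulation of a pair of pants spiralling around the boundary curves `c₁` and `c₃`
equals `e₂/(e₁e₃)`: the cross ratio `[x₃:x₁:P₁·x₂:x₂]` equals `e₂/(e₃e₁)`. -/
theorem pants_shear_bend_parameter
    (e₁ e₂ e₃ x₁ x₂ x₃ w : ℂ)
    (he₁ : e₁ ≠ 0) (he₂ : e₂ ≠ 0) (he₃ : e₃ ≠ 0)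
    (h12 : x₁ ≠ x₂) (h23 : x₂ ≠ x₃) (h13 : x₁ ≠ x₃)
    (hden : (pantsMatrix e₁ e₂ e₃ x₁ x₂ x₃) 1 0 * x₂
              + (pantsMatrix e₁ e₂ e₃ x₁ x₂ x₃) 1 1 ≠ 0)
    (hw : w = ((pantsMatrix e₁ e₂ e₃ x₁ x₂ x₃) 0 0 * x₂
                + (pantsMatrix e₁ e₂ e₃ x₁ x₂ x₃) 0 1) /
              ((pantsMatrix e₁ e₂ e₃ x₁ x₂ x₃) 1 0 * x₂
                + (pantsMatrix e₁ e₂ e₃ x₁ x₂ x₃) 1 1))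
    (h31 : x₃ ≠ x₁) (h3w : x₃ ≠ w) (h32 : x₃ ≠ x₂)
    (h1w : x₁ ≠ w) (hw2 : w ≠ x₂) :
    crossRatio x₃ x₁ w x₂ = e₂ / (e₃ * e₁) := by
  have huv : x₂ - x₁ ≠ 0 := sub_ne_zero.mpr h12.symm
  have huw : x₃ - x₁ ≠ 0 := sub_ne_zero.mpr h31
  have hvw : x₃ - x₂ ≠ 0 := sub_ne_zero.mpr h32
  rw [pantsMatrix_den _ _ _ _ _ _ huv] at hden hw
  rw [pantsMatrix_num _ _ _ _ _ _ huv,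
    div_div_div_cancel_right₀ (mul_ne_zero (mul_ne_zero he₁ he₂) huw)] at hw
  have hD : e₂ * (x₂ - x₁) + e₁ * e₃ * (x₃ - x₂) ≠ 0 := (div_ne_zero_iff.mp hden).1
  have hwD : w * (e₂ * (x₂ - x₁) + e₁ * e₃ * (x₃ - x₂))
      = e₂ * x₃ * (x₂ - x₁) + e₁ * e₃ * x₁ * (x₃ - x₂) := (eq_div_iff hD).mp hw
  have hw3 : w - x₃ ≠ 0 := sub_ne_zero.mpr h3w.symm
  rw [crossRatio, div_mul_div_comm,
    div_eq_div_iff (mul_ne_zero huv hw3) (mul_ne_zero he₃ he₁)]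
  linear_combination -hwD
end

section
/- Let e₁, e₂, e₃ ∈ ℝ with e₁ < −1, e₂ < −1, e₃ < −1. Define y₂ = ((e₁e₂−e₃)(1−e₁e₂e₃)) / ((e₂e₃−e₁)(e₁e₃−e₂)), x₃ = (−e₁(e₁e₂−e₃)) / (e₁e₃−e₂), and y₃ = (−e₁(1−e₁e₂e₃)) / (e₂e₃−e₁). Then 1 < y₂ < x₃ < y₃ < e₁². (These inequalities show that the corresponding fixed points 0 < 1 < y₂ < x₃ < y₃ < e₁² on ℝP¹ are in the cyclic order needed to build a fundamental domain, so the pants representation with x₁ = ∞, y₁ = 0, x₂ = 1 and eigenvalue parameters e₁, e₂, e₃ is discrete and faithful.) -/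
/-- for eigenvalue parameters `e₁, e₂, e₃ < −1`, the fixed points of the
normalized Fuchsian pants representation (with `x₁ = ∞`, `y₁ = 0`, `x₂ = 1`) satisfy
`1 < y₂ < x₃ < y₃ < e₁²`, the ordering needed to build a fundamental domain. -/
theorem fuchsian_pants_fixed_point_ordering
    (e₁ e₂ e₃ : ℝ) (h1 : e₁ < -1) (h2 : e₂ < -1) (h3 : e₃ < -1) :
    let y₂ : ℝ := ((e₁*e₂-e₃)*(1-e₁*e₂*e₃)) / ((e₂*e₃-e₁)*(e₁*e₃-e₂))
    let x₃ : ℝ := (-e₁*(e₁*e₂-e₃)) / (e₁*e₃-e₂)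
    let y₃ : ℝ := (-e₁*(1-e₁*e₂*e₃)) / (e₂*e₃-e₁)
    1 < y₂ ∧ y₂ < x₃ ∧ x₃ < y₃ ∧ y₃ < e₁^2 := by
  intro y₂ x₃ y₃
  have p₁ : 0 < e₁ ^ 2 - 1 := by nlinarith
  have p₂ : 0 < e₂ ^ 2 - 1 := by nlinarith
  have p₃ : 0 < e₃ ^ 2 - 1 := by nlinarith
  have h12 : 0 < e₁ * e₂ := by nlinarith
  have h13 : 0 < e₁ * e₃ := by nlinarith
  have h23 : 0 < e₂ * e₃ := by nlinarith
  have hA : 0 < e₁ * e₂ - e₃ := by linarith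
  have hB : 0 < e₁ * e₃ - e₂ := by linarith
  have hC : 0 < e₂ * e₃ - e₁ := by linarith
  refine ⟨?_, ?_, ?_, ?_⟩
  · rw [lt_div_iff₀ (mul_pos hC hB)]
    have : 0 < -e₃ * ((e₁ ^ 2 - 1) * (e₂ ^ 2 - 1)) :=
      mul_pos (by linarith) (mul_pos p₁ p₂)
    linarith
  · rw [div_lt_div_iff₀ (mul_pos hC hB) hB]
    have : 0 < (e₁ * e₂ - e₃) * (e₁ * e₃ - e₂) * (e₁ ^ 2 - 1) :=
      mul_pos (mul_pos hA hB) p₁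
    linarith
  · rw [div_lt_div_iff₀ hB hC]
    have : 0 < -e₁ * (-e₂ * ((e₁ ^ 2 - 1) * (e₃ ^ 2 - 1))) :=
      mul_pos (by linarith) (mul_pos (by linarith) (mul_pos p₁ p₃))
    linarith
  · rw [div_lt_iff₀ hC]
    have : 0 < -e₁ * (e₁ ^ 2 - 1) := mul_pos (by linarith) p₁
    linarith
end
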